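/- (i) Let s ∈ Ξ and let R_s be a positive measure on 𝒵 with Laplace transform L_{R_s}(ξ) = δ_{−s}(ξ) for ξ ∈ 𝒬. Then R_s is not concentrated on any affine hyperplane of 𝒵 if and only if s_k > 0 for all k = 1,…,r. (ii) Let s ∈ 𝔛 and let R*_s be a positive measure on 𝒵 with Laplace transform L_{R*_s}(θ) = Δ_{−s}(θ) for θ ∈ 𝒫. Then R*_s is not concentrated on any affine hyperplane of 𝒵 if and only if s_k > 0 for all k = 1,…,r. -/

import Mathlib

open Matrix MeasureTheory Finset
open scoped ENNReal

namespace Wishart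

instance {m n α : Type*} [MeasurableSpace α] : MeasurableSpace (Matrix m n α) :=
  inferInstanceAs (MeasurableSpace (m → n → α))

/-- Index set of an `N × N` matrix partitioned into `r + 1` blocks of sizes `n 0, …, n r`. -/
abbrev Idx (r : ℕ) (n : Fin (r + 1) → ℕ+) := Σ k : Fin (r + 1), Fin (n k)

/-- Real matrices over the partitioned index set. -/
abbrev Mat (r : ℕ) (n : Fin (r + 1) → ℕ+) := Matrix (Idx r n) (Idx r n) ℝ

variable {r : ℕ} {n : Fin (r + 1) → ℕ+}

/-- The `(l,k)` block of a partitioned matrix. -/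
def blk (x : Mat r n) (l k : Fin (r + 1)) : Matrix (Fin (n l)) (Fin (n k)) ℝ :=
  Matrix.of fun a b => x ⟨l, a⟩ ⟨k, b⟩

variable (V : ∀ l k : Fin (r + 1), Submodule ℝ (Matrix (Fin (n l)) (Fin (n k)) ℝ))

/-- Condition (V1): `A ∈ 𝒱_{lk}`, `B ∈ 𝒱_{ki}` implies `A B ∈ 𝒱_{li}` for `i < k < l`. -/
def CondV1 : Prop := ∀ i k l : Fin (r + 1), i < k → k < l →
  ∀ A ∈ V l k, ∀ B ∈ V k i, A * B ∈ V l i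

/-- Condition (V2): `A ∈ 𝒱_{li}`, `B ∈ 𝒱_{ki}` implies `A Bᵀ ∈ 𝒱_{lk}` for `i < k < l`. -/
def CondV2 : Prop := ∀ i k l : Fin (r + 1), i < k → k < l →
  ∀ A ∈ V l i, ∀ B ∈ V k i, A * Bᵀ ∈ V l k

/-- Condition (V3): `A ∈ 𝒱_{lk}` implies `A Aᵀ ∈ ℝ I`. -/
def CondV3 : Prop := ∀ k l : Fin (r + 1), k < l →
  ∀ A ∈ V l k, ∃ c : ℝ, A * Aᵀ = c • (1 : Matrix (Fin (n l)) (Fin (n l)) ℝ)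

/-- The space `𝒵` of symmetric matrices with lower blocks in `𝒱_{lk}` and scalar diagonal
blocks. -/
def Zspace : Set (Mat r n) :=
  {x | x.IsSymm ∧ (∀ k l : Fin (r + 1), k < l → blk x l k ∈ V l k) ∧
    ∀ k : Fin (r + 1), ∃ c : ℝ, ∀ a b : Fin (n k),
      x ⟨k, a⟩ ⟨k, b⟩ = if a = b then c else 0}

/-- The trace inner product `⟨x, y⟩ = tr (x y)`. -/
def tip (x y : Mat r n) : ℝ := (x * y).trace

/-- The homogeneous cone `𝒫 = 𝒵 ∩ Sym₊(N, ℝ)`. -/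
def Pcone : Set (Mat r n) := {x | x ∈ Zspace V ∧ x.PosDef}

/-- The dual cone `𝒬 = {ξ ∈ 𝒵 : ⟨ξ, x⟩ > 0 for all nonzero x in the closure of 𝒫}`. -/
def Qcone : Set (Mat r n) :=
  {ξ | ξ ∈ Zspace V ∧ ∀ x ∈ closure (Pcone V), x ≠ 0 → 0 < tip ξ x}

/-- The group `H` of block lower triangular matrices with strictly lower blocks in `𝒱_{lk}`
and positive scalar diagonal blocks. -/
def Hgrp : Set (Mat r n) :=
  {T | (∀ k l : Fin (r + 1), l < k → blk T l k = 0) ∧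
    (∀ k l : Fin (r + 1), k < l → blk T l k ∈ V l k) ∧
    ∀ k : Fin (r + 1), ∃ t : ℝ, 0 < t ∧ ∀ a b : Fin (n k),
      T ⟨k, a⟩ ⟨k, b⟩ = if a = b then t else 0}

/-- `ρ(T) x = T x Tᵀ`. -/
def rhoM (T x : Mat r n) : Mat r n := T * x * Tᵀ

/-- The diagonal scalar `t_{kk}` of a matrix with scalar diagonal blocks. -/
def tdiag (T : Mat r n) (k : Fin (r + 1)) : ℝ :=
  T ⟨k, ⟨0, (n k).2⟩⟩ ⟨k, ⟨0, (n k).2⟩⟩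

/-- The one-dimensional representation `χ_s(T) = ∏_k t_{kk}^{2 s_k}`. -/
noncomputable def chi (s : Fin (r + 1) → ℝ) (T : Mat r n) : ℝ :=
  ∏ k : Fin (r + 1), tdiag T k ^ (2 * s k)

/-- `½ Σ_{i<k} ε_i dim 𝒱_{ki}`. -/
noncomputable def xiBound (ε : Fin (r + 1) → Bool) (k : Fin (r + 1)) : ℝ :=
  (1 / 2) * ∑ i ∈ Finset.univ.filter (fun i => i < k),
    (if ε i then (Module.finrank ℝ (V k i) : ℝ) else 0)

/-- The Gindikin set `Ξ`. -/
def XiSet : Set (Fin (r + 1) → ℝ) :=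
  ⋃ ε : Fin (r + 1) → Bool,
    {s | ∀ k, (ε k = true → xiBound V ε k < s k) ∧ (ε k = false → s k = xiBound V ε k)}

/-- `½ Σ_{l>k} ε_l dim 𝒱_{lk}`. -/
noncomputable def frakBound (ε : Fin (r + 1) → Bool) (k : Fin (r + 1)) : ℝ :=
  (1 / 2) * ∑ l ∈ Finset.univ.filter (fun l => k < l),
    (if ε l then (Module.finrank ℝ (V l k) : ℝ) else 0)

/-- The Gindikin set `𝔛`. -/
def frakX : Set (Fin (r + 1) → ℝ) :=
  ⋃ ε : Fin (r + 1) → Bool,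
    {s | ∀ k, (ε k = true → frakBound V ε k < s k) ∧ (ε k = false → s k = frakBound V ε k)}

/-- Laplace transform `L_μ(θ) = ∫ e^{-⟨θ,x⟩} dμ(x)` (with values in `[0,∞]`). -/
noncomputable def laplace (μ : Measure (Mat r n)) (θ : Mat r n) : ℝ≥0∞ :=
  ∫⁻ x, ENNReal.ofReal (Real.exp (-(tip θ x))) ∂μ

/-- Real-valued Laplace transform. -/
noncomputable def laplaceR (μ : Measure (Mat r n)) (θ : Mat r n) : ℝ :=
  ∫ x, Real.exp (-(tip θ x)) ∂μ

/-- Mean of the natural-exponential-family member `P(θ,μ)`, computed entrywise: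
`m_μ(θ) = L_μ(θ)⁻¹ ∫ x e^{-⟨θ,x⟩} dμ(x)`. -/
noncomputable def meanMap (μ : Measure (Mat r n)) (θ : Mat r n) : Mat r n :=
  Matrix.of fun p q => (laplaceR μ θ)⁻¹ * ∫ x, Real.exp (-(tip θ x)) * x p q ∂μ

/-- Covariance operator of `P(θ,μ)` with mean `m`, applied to `ξ ∈ 𝒵` (entrywise):
`V ξ = ∫ ⟨ξ, x - m⟩ (x - m) dP(θ,μ)(x)`. -/
noncomputable def varOp (μ : Measure (Mat r n)) (θ m ξ : Mat r n) : Mat r n :=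
  Matrix.of fun p q =>
    (laplaceR μ θ)⁻¹ * ∫ x, Real.exp (-(tip θ x)) * tip ξ (x - m) * ((x - m) p q) ∂μ

/-- Leading principal submatrix `y_{{1:k}}` consisting of the blocks with indices `≤ k`. -/
def lead (k : Fin (r + 1)) (y : Mat r n) :
    Matrix {p : Idx r n // p.1 ≤ k} {p : Idx r n // p.1 ≤ k} ℝ :=
  Matrix.of fun p q => y p.1 q.1

/-- Zero-padding `z₀` of a matrix `z` defined on the blocks with indices `≤ k`. -/
def pad (k : Fin (r + 1)) (z : Matrix {p : Idx r n // p.1 ≤ k} {p : Idx r n // p.1 ≤ k} ℝ) :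
    Mat r n :=
  Matrix.of fun p q => if h : p.1 ≤ k ∧ q.1 ≤ k then z ⟨p, h.1⟩ ⟨q, h.2⟩ else 0

/-- `J_k = (I_{N_k})₀`. -/
def Jmat (k : Fin (r + 1)) : Mat r n := pad k 1

/-- Parameters of elements of `W_i`: the scalar `x_{ii}` and the blocks `X_{li}`. -/
abbrev Wparam (r : ℕ) (n : Fin (r + 1) → ℕ+) (i : Fin (r + 1)) :=
  ℝ × ∀ l : Fin (r + 1), Matrix (Fin (n l)) (Fin (n i)) ℝ

/-- The `N × n_i` matrix in `W_i` with `i`-th block row `x_{ii} I` and `l`-th block row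
`X_{li}` for `l > i`. -/
def toW (i : Fin (r + 1)) (p : Wparam r n i) : Matrix (Idx r n) (Fin (n i)) ℝ :=
  Matrix.of fun q b =>
    if q.1 = i then (if (q.2 : ℕ) = (b : ℕ) then p.1 else 0)
    else if i < q.1 then p.2 q.1 q.2 b else 0

/-- A parameter tuple gives an honest element of `W_i`: blocks lie in `𝒱_{li}` and vanish
for `l ≤ i`. -/
def WGood (i : Fin (r + 1)) (p : Wparam r n i) : Prop :=
  (∀ l : Fin (r + 1), i < l → p.2 l ∈ V l i) ∧ (∀ l : Fin (r + 1), ¬ i < l → p.2 l = 0)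

/-- The inner product `(A|B)` on `𝒱_{lk}`, characterized by `(ABᵀ + BAᵀ)/2 = (A|B) I`. -/
noncomputable def bip (l : Fin (r + 1)) {k : Fin (r + 1)}
    (A B : Matrix (Fin (n l)) (Fin (n k)) ℝ) : ℝ :=
  (A * Bᵀ).trace / (n l : ℝ)

open scoped Classical in
/-- The generalized power function `Δ_s` on `𝒫`, defined by `Δ_s(ρ(T) I) = χ_s(T)`. -/
noncomputable def DeltaDef (s : Fin (r + 1) → ℝ) (x : Mat r n) : ℝ :=
  if h : ∃ T, T ∈ Hgrp V ∧ x = rhoM T 1 then chi s h.choose else 0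

/-- Index set for the block diagonal matrix `Φ(ξ) = diag(φ_0(ξ), …, φ_r(ξ))`,
where `φ_i(ξ)` is of size `m_i = mdc i + 1`. -/
abbrev DIdx (r : ℕ) (mdc : Fin (r + 1) → ℕ) := Σ i : Fin (r + 1), Fin (mdc i + 1)

/-- The block diagonal matrix `Φ(ξ) = diag(φ_0(ξ), …, φ_r(ξ))`. -/
def PhiMat {mdc : Fin (r + 1) → ℕ}
    (φ : ∀ i : Fin (r + 1), Mat r n → Matrix (Fin (mdc i + 1)) (Fin (mdc i + 1)) ℝ)
    (ξ : Mat r n) : Matrix (DIdx r mdc) (DIdx r mdc) ℝ :=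
  Matrix.of fun p q =>
    if h : p.1 = q.1 then φ p.1 ξ p.2 (Fin.cast (by rw [h]) q.2) else 0

/-- `Φ(I_N)^{-1/2}`: the inverse square root of the (diagonal, positive) matrix `Φ(I_N)`. -/
noncomputable def PhiISqrtInv {mdc : Fin (r + 1) → ℕ}
    (φ : ∀ i : Fin (r + 1), Mat r n → Matrix (Fin (mdc i + 1)) (Fin (mdc i + 1)) ℝ) :
    Matrix (DIdx r mdc) (DIdx r mdc) ℝ :=
  Matrix.diagonal fun p => (PhiMat φ (1 : Mat r n) p p) ^ (-(1 / 2) : ℝ)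

open scoped MatrixOrder in
theorem trace_mul_pos_of_posDef {ι : Type*} [Fintype ι] {y x : Matrix ι ι ℝ}
    (hy : y.PosDef) (hx : x.PosSemidef) (hx0 : x ≠ 0) : 0 < (y * x).trace := by
  classical
  obtain ⟨z, hz, rfl⟩ := CStarAlgebra.isStrictlyPositive_iff_eq_star_mul_self.mp
    hy.isStrictlyPositive
  have h1 : (star z * z * x).trace = (z * x * zᴴ).trace := by
    rw [Matrix.star_eq_conjTranspose, Matrix.mul_assoc, Matrix.trace_mul_comm]
  have h2 := hx.mul_mul_conjTranspose_same z
  rw [h1]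
  refine lt_of_le_of_ne h2.trace_nonneg fun h => hx0 ?_
  have h3 := h2.trace_eq_zero_iff.mp h.symm
  have hz' : IsUnit zᴴ := by simpa [Matrix.star_eq_conjTranspose] using hz.star
  have h4 : z * x = 0 := by
    apply hz'.mul_right_cancel
    rw [h3, Matrix.zero_mul]
  apply hz.mul_left_cancel
  rw [h4, Matrix.mul_zero]

theorem isClosed_setOf_posSemidef {ι : Type*} [Fintype ι] :
    IsClosed {x : Matrix ι ι ℝ | x.PosSemidef} := by
  have h : {x : Matrix ι ι ℝ | x.PosSemidef} =
      {x | xᵀ = x} ∩ ⋂ v : ι → ℝ, {x | 0 ≤ v ⬝ᵥ (x *ᵥ v)} := by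
    ext x
    simp [Matrix.posSemidef_iff_dotProduct_mulVec, Matrix.IsHermitian]
  rw [h]
  refine (isClosed_eq (by fun_prop) continuous_id).inter (isClosed_iInter fun v => ?_)
  exact isClosed_le continuous_const (by fun_prop)

/-- A small symmetric perturbation of the identity is positive definite. -/
theorem exists_posDef_one_add_smul {ι : Type*} [Fintype ι] [DecidableEq ι] {v : Matrix ι ι ℝ}
    (hv : v.IsSymm) : ∃ ε > 0, ∀ t : ℝ, |t| ≤ ε → (1 + t • v).PosDef := by
  set M : ℝ := ∑ p, ∑ q, |v p q| with hM
  have hM0 : 0 ≤ M := by positivity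
  refine ⟨1 / (M + 1), by positivity, fun t ht => ?_⟩
  refine .of_dotProduct_mulVec_pos ?_ fun x hx => ?_
  · simp [Matrix.IsHermitian, hv.eq]
  have hS : 0 < x ⬝ᵥ x := by
    have := Matrix.dotProduct_star_self_pos_iff.mpr hx
    simpa using this
  have hle : ∀ p, x p ^ 2 ≤ x ⬝ᵥ x := fun p => by
    rw [sq]
    exact Finset.single_le_sum (f := fun i => x i * x i) (fun i _ => mul_self_nonneg _)
      (Finset.mem_univ p)
  have hb : |x ⬝ᵥ (v *ᵥ x)| ≤ M * (x ⬝ᵥ x) := by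
    have : x ⬝ᵥ (v *ᵥ x) = ∑ p, ∑ q, v p q * (x p * x q) := by
      simp only [dotProduct, Matrix.mulVec, Finset.mul_sum]
      exact Finset.sum_congr rfl fun p _ => Finset.sum_congr rfl fun q _ => by ring
    rw [this, hM, Finset.sum_mul]
    refine (Finset.abs_sum_le_sum_abs _ _).trans (Finset.sum_le_sum fun p _ => ?_)
    rw [Finset.sum_mul]
    refine (Finset.abs_sum_le_sum_abs _ _).trans (Finset.sum_le_sum fun q _ => ?_)
    rw [abs_mul]
    refine mul_le_mul_of_nonneg_left ?_ (abs_nonneg _)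
    rw [abs_le]
    constructor <;> nlinarith [hle p, hle q, sq_nonneg (x p - x q), sq_nonneg (x p + x q)]
  have h1 : |t * (x ⬝ᵥ (v *ᵥ x))| < x ⬝ᵥ x := by
    rw [abs_mul]
    calc |t| * |x ⬝ᵥ (v *ᵥ x)| ≤ 1 / (M + 1) * (M * (x ⬝ᵥ x)) := by gcongr
      _ = M / (M + 1) * (x ⬝ᵥ x) := by ring
      _ < 1 * (x ⬝ᵥ x) := by
        refine mul_lt_mul_of_pos_right ?_ hS
        rw [div_lt_one (by positivity)]; linarith
      _ = x ⬝ᵥ x := one_mul _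
  have h2 := (abs_lt.mp h1).1
  simp only [star_trivial, Matrix.add_mulVec, Matrix.one_mulVec, Matrix.smul_mulVec,
    dotProduct_add, dotProduct_smul, smul_eq_mul]
  linarith

/-! ### Block-scalar diagonal matrices -/

/-- The diagonal matrix with scalar blocks `d k • 1`. -/
def dg (d : Fin (r + 1) → ℝ) : Mat r n := Matrix.diagonal fun p => d p.1

/-- The projection onto the `k`-th block. -/
def E (k : Fin (r + 1)) : Mat r n := dg (Pi.single k 1)

theorem dg_mul_apply (d : Fin (r + 1) → ℝ) (x : Mat r n) (a b : Idx r n) :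
    (dg d * x : Mat r n) a b = d a.1 * x a b := by
  simp [dg, Matrix.diagonal_mul]

theorem mul_dg_apply (d : Fin (r + 1) → ℝ) (x : Mat r n) (a b : Idx r n) :
    (x * dg d : Mat r n) a b = x a b * d b.1 := by
  simp [dg, Matrix.mul_diagonal]

theorem E_mul_apply (k : Fin (r + 1)) (x : Mat r n) (a b : Idx r n) :
    (E k * x : Mat r n) a b = if a.1 = k then x a b else 0 := by
  simp [E, dg_mul_apply, Pi.single_apply]

theorem mul_E_apply (k : Fin (r + 1)) (x : Mat r n) (a b : Idx r n) :
    (x * E k : Mat r n) a b = if b.1 = k then x a b else 0 := by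
  simp [E, mul_dg_apply, Pi.single_apply]

theorem E_apply (k : Fin (r + 1)) (a b : Idx r n) :
    (E k : Mat r n) a b = if b.1 = k then (if a = b then 1 else 0) else 0 := by
  simp only [E, dg, Matrix.diagonal_apply, Pi.single_apply]
  grind

theorem dg_mul_dg (d d' : Fin (r + 1) → ℝ) : (dg d * dg d' : Mat r n) = dg (d * d') := by
  simp [dg, Matrix.diagonal_mul_diagonal]

theorem dg_transpose (d : Fin (r + 1) → ℝ) : (dg d : Mat r n)ᵀ = dg d := by
  simp [dg]

theorem E_transpose (k : Fin (r + 1)) : (E k : Mat r n)ᵀ = E k := dg_transpose _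

theorem one_eq_dg : (1 : Mat r n) = dg 1 := by
  simp [dg]

theorem E_mul_E_self (k : Fin (r + 1)) : (E k * E k : Mat r n) = E k := by
  ext a b
  simp only [mul_E_apply, E_apply]
  grind

theorem E_mul_E_of_ne {k l : Fin (r + 1)} (h : k ≠ l) : (E k * E l : Mat r n) = 0 := by
  ext a b
  simp only [mul_E_apply, E_apply, Matrix.zero_apply]
  grind

theorem E_ne_zero (k : Fin (r + 1)) : (E k : Mat r n) ≠ 0 := fun h => by
  have := congrFun (congrFun h ⟨k, ⟨0, (n k).2⟩⟩) ⟨k, ⟨0, (n k).2⟩⟩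
  simp [E_apply] at this

/-! ### The trace inner product -/

theorem tip_add_left (x y z : Mat r n) : tip (x + y) z = tip x z + tip y z := by
  simp [tip, Matrix.add_mul]

theorem tip_sub_left (x y z : Mat r n) : tip (x - y) z = tip x z - tip y z := by
  simp [tip, Matrix.sub_mul]

theorem tip_smul_left (c : ℝ) (x y : Mat r n) : tip (c • x) y = c * tip x y := by
  simp [tip]

theorem tip_add_right (x y z : Mat r n) : tip x (y + z) = tip x y + tip x z := by
  simp [tip, Matrix.mul_add]

theorem tip_smul_right (c : ℝ) (x y : Mat r n) : tip x (c • y) = c * tip x y := by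
  simp [tip]

theorem tip_rhoM (y T x : Mat r n) : tip y (rhoM T x) = tip (Tᵀ * y * T) x := by
  simp only [tip, rhoM]
  rw [← Matrix.mul_assoc, Matrix.trace_mul_comm]
  simp only [Matrix.mul_assoc]

theorem tip_transpose_self (x : Mat r n) : tip xᵀ x = 0 ↔ x = 0 := by
  simpa [tip] using Matrix.trace_conjTranspose_mul_self_eq_zero_iff (A := x)

/-! ### The space `𝒵` and the algebra of block lower triangular matrices -/

theorem diag_block_iff (x : Mat r n) (k : Fin (r + 1)) (c : ℝ) :
    (∀ a b : Fin (n k), x ⟨k, a⟩ ⟨k, b⟩ = if a = b then c else 0) ↔ blk x k k = c • 1 := by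
  simp [← Matrix.ext_iff, blk, Matrix.one_apply]

/-- `𝒵` as a subspace. -/
def Zsub : Submodule ℝ (Mat r n) where
  carrier := Zspace V
  add_mem' := by
    rintro x y ⟨hx, hx', hx''⟩ ⟨hy, hy', hy''⟩
    refine ⟨hx.add hy, fun k l h => (V l k).add_mem (hx' k l h) (hy' k l h), fun k => ?_⟩
    obtain ⟨c, hc⟩ := hx'' k
    obtain ⟨d, hd⟩ := hy'' k
    refine ⟨c + d, fun a b => ?_⟩
    rw [Matrix.add_apply, hc, hd]
    split_ifs <;> simp
  zero_mem' := ⟨Matrix.isSymm_zero, fun k l _ => (V l k).zero_mem, fun k => ⟨0, by simp⟩⟩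
  smul_mem' := by
    rintro t x ⟨hx, hx', hx''⟩
    refine ⟨hx.smul t, fun k l h => (V l k).smul_mem t (hx' k l h), fun k => ?_⟩
    obtain ⟨c, hc⟩ := hx'' k
    refine ⟨t * c, fun a b => ?_⟩
    rw [Matrix.smul_apply, hc]
    split_ifs <;> simp

/-- Block lower triangular matrices with strictly lower blocks in `𝒱_{lk}` and scalar diagonal
blocks. -/
def IsLower (T : Mat r n) : Prop :=
  (∀ k l : Fin (r + 1), l < k → blk T l k = 0) ∧
    (∀ k l : Fin (r + 1), k < l → blk T l k ∈ V l k) ∧ ∀ k, ∃ t : ℝ, blk T k k = t • 1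

variable {V}

theorem blk_mul (x y : Mat r n) (l k : Fin (r + 1)) :
    blk (x * y) l k = ∑ i, blk x l i * blk y i k := by
  ext a b
  simp [blk, Matrix.mul_apply, Fintype.sum_sigma, Matrix.sum_apply]

theorem blk_transpose (x : Mat r n) (l k : Fin (r + 1)) : blk xᵀ l k = (blk x k l)ᵀ := rfl

theorem blk_add (x y : Mat r n) (l k : Fin (r + 1)) : blk (x + y) l k = blk x l k + blk y l k :=
  rfl

theorem IsLower.add {x y : Mat r n} (hx : IsLower V x) (hy : IsLower V y) :
    IsLower V (x + y) := by
  refine ⟨fun k l h => ?_, fun k l h => ?_, fun k => ?_⟩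
  · rw [blk_add, hx.1 k l h, hy.1 k l h, add_zero]
  · exact (V l k).add_mem (hx.2.1 k l h) (hy.2.1 k l h)
  · obtain ⟨c, hc⟩ := hx.2.2 k
    obtain ⟨d, hd⟩ := hy.2.2 k
    exact ⟨c + d, by rw [blk_add, hc, hd, add_smul]⟩

theorem blk_mul_diag {x y : Mat r n} (hx : IsLower V x) (hy : IsLower V y) (k : Fin (r + 1)) :
    blk (x * y) k k = blk x k k * blk y k k := by
  rw [blk_mul]
  refine Finset.sum_eq_single k (fun i _ hi => ?_) (by simp)
  rcases lt_or_gt_of_ne hi with h | h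
  · rw [hy.1 k i h, Matrix.mul_zero]
  · rw [hx.1 i k h, Matrix.zero_mul]

theorem IsLower.mul (hV1 : CondV1 V) {x y : Mat r n} (hx : IsLower V x) (hy : IsLower V y) :
    IsLower V (x * y) := by
  refine ⟨fun k l h => ?_, fun k l h => ?_, fun k => ?_⟩
  · rw [blk_mul]
    refine Finset.sum_eq_zero fun i _ => ?_
    rcases lt_or_ge l i with hi | hi
    · rw [hx.1 i l hi, Matrix.zero_mul]
    · rw [hy.1 k i (hi.trans_lt h), Matrix.mul_zero]
  · rw [blk_mul]
    refine Submodule.sum_mem _ fun i _ => ?_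
    rcases lt_trichotomy i k with hi | rfl | hi
    · simp [hy.1 k i hi]
    · obtain ⟨t, ht⟩ := hy.2.2 i
      rw [ht, Matrix.mul_smul, Matrix.mul_one]
      exact (V l i).smul_mem t (hx.2.1 i l h)
    · rcases lt_trichotomy i l with hl | rfl | hl
      · exact hV1 k i l hi hl _ (hx.2.1 i l hl) _ (hy.2.1 k i hi)
      · obtain ⟨t, ht⟩ := hx.2.2 i
        rw [ht, Matrix.smul_mul, Matrix.one_mul]
        exact (V i k).smul_mem t (hy.2.1 k i h)
      · simp [hx.1 i l hl]
  · obtain ⟨c, hc⟩ := hx.2.2 k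
    obtain ⟨d, hd⟩ := hy.2.2 k
    exact ⟨c * d, by rw [blk_mul_diag hx hy, hc, hd]; simp [smul_smul, mul_comm]⟩

theorem IsLower.mul_transpose_self_mem (hV2 : CondV2 V) (hV3 : CondV3 V) {x : Mat r n}
    (hx : IsLower V x) : x * xᵀ ∈ Zsub V := by
  refine ⟨by simp [Matrix.IsSymm], fun k l h => ?_, fun k => ?_⟩
  · rw [blk_mul]
    refine Submodule.sum_mem _ fun i _ => ?_
    rw [blk_transpose]
    rcases lt_trichotomy i k with hi | rfl | hi
    · exact hV2 i k l hi h _ (hx.2.1 i l (hi.trans h)) _ (hx.2.1 i k hi)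
    · obtain ⟨t, ht⟩ := hx.2.2 i
      rw [ht, Matrix.transpose_smul, Matrix.transpose_one, Matrix.mul_smul, Matrix.mul_one]
      exact (V l i).smul_mem t (hx.2.1 i l h)
    · simp [hx.1 i k hi]
  · have h : ∀ i, ∃ c : ℝ, blk x k i * (blk x k i)ᵀ = c • 1 := fun i => by
      rcases lt_trichotomy i k with hi | rfl | hi
      · exact hV3 i k hi _ (hx.2.1 i k hi)
      · obtain ⟨t, ht⟩ := hx.2.2 i
        exact ⟨t * t, by simp [ht, smul_smul]⟩
      · exact ⟨0, by simp [hx.1 i k hi]⟩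
    choose c hc using h
    refine ⟨∑ i, c i, (diag_block_iff _ _ _).mpr ?_⟩
    rw [blk_mul, Finset.sum_smul]
    exact Finset.sum_congr rfl fun i _ => hc i

theorem exists_isLower_add_transpose {x : Mat r n} (hx : x ∈ Zspace V) :
    ∃ y, IsLower V y ∧ x = y + yᵀ := by
  obtain ⟨h1, h2, h3⟩ := hx
  refine ⟨Matrix.of fun p q => if q.1 < p.1 then x p q else if p.1 = q.1 then x p q / 2 else 0,
    ⟨fun k l h => ?_, fun k l h => ?_, fun k => ?_⟩, ?_⟩
  · ext a b
    simp [blk, h.not_gt, h.ne]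
  · convert h2 k l h using 1
    ext a b
    simp [blk, h]
  · obtain ⟨c, hc⟩ := h3 k
    refine ⟨c / 2, ?_⟩
    ext a b
    simp only [blk, Matrix.of_apply, lt_irrefl, if_false, if_true, hc, Matrix.smul_apply,
      Matrix.one_apply, smul_eq_mul]
    split_ifs <;> simp
  · ext p q
    have := h1.apply p q
    simp only [Matrix.add_apply, Matrix.of_apply, Matrix.transpose_apply]
    rcases lt_trichotomy p.1 q.1 with h | h | h
    · simp [h, h.not_gt, h.ne, this]
    · simp [h, this]
    · simp [h, h.not_gt, h.ne]

theorem mem_Hgrp_iff {T : Mat r n} :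
    T ∈ Hgrp V ↔ IsLower V T ∧ ∀ k, 0 < tdiag T k := by
  constructor
  · rintro ⟨h1, h2, h3⟩
    refine ⟨⟨h1, h2, fun k => ?_⟩, fun k => ?_⟩ <;> obtain ⟨t, ht, h⟩ := h3 k
    · exact ⟨t, (diag_block_iff _ _ _).mp h⟩
    · simpa [tdiag, h] using ht
  · rintro ⟨⟨h1, h2, h3⟩, h⟩
    refine ⟨h1, h2, fun k => ?_⟩
    obtain ⟨t, ht⟩ := h3 k
    have ht' := (diag_block_iff _ _ _).mpr ht
    exact ⟨t, by simpa [tdiag, ht'] using h k, ht'⟩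

theorem tdiag_mul {T S : Mat r n} (hT : IsLower V T) (hS : IsLower V S) (k : Fin (r + 1)) :
    tdiag (T * S) k = tdiag T k * tdiag S k := by
  obtain ⟨t, ht⟩ := hT.2.2 k
  obtain ⟨u, hu⟩ := hS.2.2 k
  have h := blk_mul_diag hT hS k
  rw [ht, hu] at h
  have e : ∀ x : Mat r n, tdiag x k = blk x k k ⟨0, (n k).2⟩ ⟨0, (n k).2⟩ := fun x => rfl
  rw [e, e, e, h, ht, hu]
  simp [mul_comm]

theorem mul_mem_Hgrp (hV1 : CondV1 V) {T S : Mat r n} (hT : T ∈ Hgrp V) (hS : S ∈ Hgrp V) :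
    T * S ∈ Hgrp V := by
  rw [mem_Hgrp_iff] at *
  exact ⟨hT.1.mul hV1 hS.1, fun k => by
    rw [tdiag_mul hT.1 hS.1]; exact mul_pos (hT.2 k) (hS.2 k)⟩

theorem chi_mul (s : Fin (r + 1) → ℝ) {T S : Mat r n} (hT : T ∈ Hgrp V) (hS : S ∈ Hgrp V) :
    chi s (T * S) = chi s T * chi s S := by
  rw [mem_Hgrp_iff] at *
  simp only [chi, tdiag_mul hT.1 hS.1, ← Finset.prod_mul_distrib]
  exact Finset.prod_congr rfl fun k _ => Real.mul_rpow (hT.2 k).le (hS.2 k).le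

theorem chi_pos (s : Fin (r + 1) → ℝ) {T : Mat r n} (hT : T ∈ Hgrp V) : 0 < chi s T :=
  Finset.prod_pos fun k _ => Real.rpow_pos_of_pos ((mem_Hgrp_iff.mp hT).2 k) _

theorem dg_mem_Hgrp {d : Fin (r + 1) → ℝ} (hd : ∀ k, 0 < d k) : (dg d : Mat r n) ∈ Hgrp V := by
  refine ⟨fun k l h => ?_, fun k l h => ?_, fun k => ⟨d k, hd k, fun a b => ?_⟩⟩
  · ext a b
    simp [blk, dg, h.ne]
  · convert (V l k).zero_mem
    ext a b
    simp [blk, dg, h.ne']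
  · simp [dg, Matrix.diagonal_apply]

theorem chi_dg (s d : Fin (r + 1) → ℝ) : chi s (dg d : Mat r n) = ∏ k, d k ^ (2 * s k) := by
  simp [chi, tdiag, dg]

theorem isUnit_of_mem_Hgrp {T : Mat r n} (hT : T ∈ Hgrp V) : IsUnit T := by
  rw [Matrix.isUnit_iff_isUnit_det, ← Matrix.det_transpose, isUnit_iff_ne_zero]
  have hb : Tᵀ.BlockTriangular (fun p : Idx r n => p.1) := by
    rintro ⟨k, a⟩ ⟨l, b⟩ h
    exact congrFun (congrFun (hT.1 k l h) b) a
  rw [hb.det_fintype]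
  refine Finset.prod_ne_zero_iff.mpr fun k _ => ?_
  obtain ⟨t, ht, h⟩ := hT.2.2 k
  have : Tᵀ.toSquareBlock (fun p : Idx r n => p.1) k = t • 1 := by
    ext ⟨⟨i, a⟩, hi⟩ ⟨⟨j, b⟩, hj⟩
    subst hi
    obtain rfl : i = j := hj.symm
    simp [Matrix.toSquareBlock, Matrix.toSquareBlockProp, h, Matrix.one_apply, eq_comm]
  rw [this, Matrix.det_smul, Matrix.det_one, mul_one]
  positivity

theorem mul_add_transpose_mem (hV2 : CondV2 V) (hV3 : CondV3 V) {x y : Mat r n}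
    (hx : IsLower V x) (hy : IsLower V y) : x * yᵀ + y * xᵀ ∈ Zsub V := by
  have h := (Zsub V).sub_mem ((Zsub V).sub_mem ((hx.add hy).mul_transpose_self_mem hV2 hV3)
    (hx.mul_transpose_self_mem hV2 hV3)) (hy.mul_transpose_self_mem hV2 hV3)
  convert h using 1
  rw [Matrix.transpose_add]
  noncomm_ring

theorem rhoM_mem_Zsub (hV1 : CondV1 V) (hV2 : CondV2 V) (hV3 : CondV3 V) {T x : Mat r n}
    (hT : T ∈ Hgrp V) (hx : x ∈ Zspace V) : rhoM T x ∈ Zsub V := by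
  obtain ⟨y, hy, rfl⟩ := exists_isLower_add_transpose hx
  have hT' := (mem_Hgrp_iff.mp hT).1
  convert mul_add_transpose_mem hV2 hV3 (hT'.mul hV1 hy) hT' using 1
  rw [rhoM, Matrix.transpose_mul]
  noncomm_ring

theorem rhoM_mem_Pcone (hV1 : CondV1 V) (hV2 : CondV2 V) (hV3 : CondV3 V) {T x : Mat r n}
    (hT : T ∈ Hgrp V) (hx : x ∈ Pcone V) : rhoM T x ∈ Pcone V := by
  refine ⟨rhoM_mem_Zsub hV1 hV2 hV3 hT hx.1, ?_⟩
  have h := hx.2.mul_mul_conjTranspose_same (B := T)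
    (Matrix.vecMul_injective_of_isUnit (isUnit_of_mem_Hgrp hT))
  simpa [rhoM] using h
theorem dg_mul_mul_dg_mem {x : Mat r n} (hx : x ∈ Zspace V) (d : Fin (r + 1) → ℝ) :
    dg d * x * dg d ∈ Zsub V := by
  refine ⟨?_, fun k l h => ?_, fun k => ?_⟩
  · simp [Matrix.IsSymm, dg_transpose, hx.1.eq, Matrix.mul_assoc]
  · convert (V l k).smul_mem (d l * d k) (hx.2.1 k l h) using 1
    ext a b
    simp only [blk, Matrix.of_apply, mul_dg_apply, dg_mul_apply, Matrix.smul_apply, smul_eq_mul]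
    ring
  · obtain ⟨c, hc⟩ := hx.2.2 k
    refine ⟨d k * c * d k, fun a b => ?_⟩
    rw [mul_dg_apply, dg_mul_apply, hc]
    split_ifs <;> simp

theorem E_mem_Zsub (k : Fin (r + 1)) : (E k : Mat r n) ∈ Zsub V := by
  refine ⟨E_transpose k, fun i l h => ?_, fun i => ⟨if i = k then 1 else 0, fun a b => ?_⟩⟩
  · convert (V l i).zero_mem
    ext a b
    simp [blk, E_apply, h.ne']
  · simp only [E_apply, Sigma.mk.injEq, heq_eq_eq, true_and]
    split_ifs <;> rfl

theorem one_mem_Pcone : (1 : Mat r n) ∈ Pcone V := by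
  refine ⟨⟨Matrix.isSymm_one, fun k l h => ?_, fun k => ⟨1, fun a b => ?_⟩⟩, .one⟩
  · convert (V l k).zero_mem
    ext a b
    simp [blk, h.ne']
  · simp [Matrix.one_apply]

theorem dg_one_add_single (k : Fin (r + 1)) (t : ℝ) :
    (dg (1 + Pi.single k t) : Mat r n) = 1 + t • E k := by
  ext a b
  simp only [dg, Matrix.diagonal_apply, Pi.add_apply, Pi.one_apply, Pi.single_apply,
    Matrix.add_apply, Matrix.one_apply, Matrix.smul_apply, E_apply, smul_eq_mul]
  grind

theorem E_mul_add_mul_E_mem {x : Mat r n} (hx : x ∈ Zspace V) (k : Fin (r + 1)) :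
    E k * x + x * E k ∈ Zsub V := by
  have h1 := dg_mul_mul_dg_mem hx (1 + Pi.single k 1)
  have h2 := dg_mul_mul_dg_mem hx (Pi.single k 1)
  have h := (Zsub V).sub_mem ((Zsub V).sub_mem h1 h2) hx
  convert h using 1
  rw [dg_one_add_single, one_smul, ← E]
  noncomm_ring

theorem exists_E_mul_mul_E_eq {x : Mat r n} (hx : x ∈ Zspace V) (k : Fin (r + 1)) :
    ∃ c : ℝ, E k * x * E k = c • E k := by
  obtain ⟨c, hc⟩ := hx.2.2 k
  refine ⟨c, ?_⟩
  ext ⟨i, a⟩ ⟨j, b⟩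
  simp only [mul_E_apply, E_mul_apply, Matrix.smul_apply, E_apply, smul_eq_mul]
  by_cases hj : j = k
  · by_cases hi : i = k
    · subst hi hj
      simp [hc]
    · simp [hi, show i ≠ j from fun h => hi (h.trans hj)]
  · simp [hj]

theorem tip_E (x : Mat r n) (k : Fin (r + 1)) : tip x (E k) = (E k * x * E k).trace := by
  rw [Matrix.trace_mul_comm, ← Matrix.mul_assoc, E_mul_E_self, Matrix.trace_mul_comm, tip]

theorem tip_ext {x y : Mat r n} (hx : x ∈ Zspace V) (hy : y ∈ Zspace V)
    (h : ∀ z ∈ Zspace V, tip x z = tip y z) : x = y := by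
  have hz : x - y ∈ Zsub V := (Zsub V).sub_mem hx hy
  rw [← sub_eq_zero, ← tip_transpose_self, hz.1.eq, tip_sub_left, h _ hz, sub_self]

/-- A linear functional on `𝒵` is represented by an element of `𝒵`. -/
theorem exists_tip_eq (f : Mat r n →ₗ[ℝ] ℝ) :
    ∃ v ∈ Zspace V, ∀ x ∈ Zspace V, f x = tip v x := by
  let g : Zsub V →ₗ[ℝ] Module.Dual ℝ (Zsub V) :=
    LinearMap.mk₂ ℝ (fun x y => tip x.1 y.1) (fun x y z => tip_add_left _ _ _)
      (fun c x y => tip_smul_left _ _ _) (fun x y z => tip_add_right _ _ _)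
      (fun c x y => tip_smul_right _ _ _)
  have hg : Function.Injective g := fun x y h =>
    Subtype.ext (tip_ext x.2 y.2 fun z hz => LinearMap.congr_fun h ⟨z, hz⟩)
  obtain ⟨v, hv⟩ := (LinearMap.injective_iff_surjective_of_finrank_eq_finrank
    Subspace.dual_finrank_eq.symm).mp hg (f.domRestrict (Zsub V))
  exact ⟨v.1, v.2, fun x hx => (LinearMap.congr_fun hv ⟨x, hx⟩).symm⟩

/-- Unipotent elements of `H`. -/
theorem one_add_smul_mem_Hgrp {x : Mat r n} (hx : x ∈ Zspace V) {d d' : Fin (r + 1) → ℝ}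
    (hd : ∀ l j, l ≤ j → d l * d' j = 0) (t : ℝ) : 1 + t • (dg d * x * dg d') ∈ Hgrp V := by
  have e : ∀ a b : Idx r n, (1 + t • (dg d * x * dg d') : Mat r n) a b =
      (if a = b then 1 else 0) + t * (d a.1 * d' b.1) * x a b := fun a b => by
    simp only [Matrix.add_apply, Matrix.one_apply, Matrix.smul_apply, mul_dg_apply, dg_mul_apply,
      smul_eq_mul]
    ring
  refine ⟨fun k l h => ?_, fun k l h => ?_, fun k => ⟨1, one_pos, fun a b => ?_⟩⟩
  · ext a b
    simp [blk, e, h.ne, hd l k h.le]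
  · convert (V l k).smul_mem (t * (d l * d' k)) (hx.2.1 k l h)
    ext a b
    simp [blk, e, h.ne']
  · simp [e, hd k k le_rfl]

theorem one_add_smul_mul_one_add_smul {d d' : Fin (r + 1) → ℝ} (hd : d' * d = 0) (x : Mat r n)
    (t : ℝ) : (1 + t • (dg d * x * dg d')) * (1 + (-t) • (dg d * x * dg d')) = 1 := by
  have h : dg d * x * dg d' * (dg d * x * dg d') = 0 := by
    calc _ = dg d * x * (dg d' * dg d) * x * dg d' := by simp only [Matrix.mul_assoc]
      _ = 0 := by rw [dg_mul_dg, hd]; simp [dg]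
  simp only [Matrix.mul_add, Matrix.add_mul, Matrix.smul_mul, Matrix.mul_smul, h]
  simp

section elimination

variable {x : Mat r n} {k : Fin (r + 1)} {c : ℝ} {d : Fin (r + 1) → ℝ}

theorem elimination_mul_E (hx : xᵀ = x) (hc : c ≠ 0) (hk : E k * x * E k = c • E k)
    (hdk : d k = 0) (hd : ∀ j ≠ k, d j = 1 ∨ ∃ a : ℝ, x * E j = a • E j) :
    (1 + (-c⁻¹) • (E k * x * dg d))ᵀ * x * (1 + (-c⁻¹) • (E k * x * dg d)) * E k = c • E k := by
  have h0 : (dg d * E k : Mat r n) = 0 := by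
    ext a b
    simp only [dg_mul_apply, E_apply, Matrix.zero_apply]
    grind
  have h1 : (1 + (-c⁻¹) • (E k * x * dg d)) * E k = E k := by
    rw [Matrix.add_mul, Matrix.smul_mul, Matrix.mul_assoc, h0]
    simp
  have h2 : x * E k - dg d * x * E k = c • E k := by
    ext a b
    have hab := congrFun (congrFun hk a) b
    simp only [mul_E_apply, E_mul_apply, Matrix.smul_apply, E_apply, smul_eq_mul, dg_mul_apply,
      Matrix.sub_apply] at hab ⊢
    by_cases hb : b.1 = k
    · by_cases ha : a.1 = k
      · simpa [ha, hb, hdk] using hab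
      · have hne : a ≠ b := fun h => ha (h ▸ hb)
        rcases hd a.1 ha with h | ⟨t, ht⟩
        · simp [h, hb, hne]
        · have := congrFun (congrFun ht b) a
          simp only [mul_E_apply, Matrix.smul_apply, E_apply, if_true, hne.symm, if_false,
            smul_eq_mul, mul_zero] at this
          have hs : x a b = x b a := congrFun (congrFun hx b) a
          simp [hs, this, hne]
    · simp [hb]
  rw [Matrix.mul_assoc, h1, Matrix.transpose_add, Matrix.transpose_smul, Matrix.transpose_mul,
    Matrix.transpose_mul, E_transpose, dg_transpose, hx, Matrix.transpose_one]
  calc _ = x * E k + (-c⁻¹) • (dg d * x * (E k * E k) * x * E k) := by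
        rw [E_mul_E_self]
        simp only [Matrix.add_mul, Matrix.smul_mul, Matrix.one_mul, Matrix.mul_assoc]
    _ = x * E k + (-c⁻¹) • (dg d * x * E k * (E k * x * E k)) := by
        simp only [Matrix.mul_assoc]
    _ = x * E k - dg d * x * E k := by
        rw [hk, Matrix.mul_smul, Matrix.mul_assoc _ (E k), E_mul_E_self, smul_smul]
        simp [hc, sub_eq_add_neg]
    _ = _ := h2

theorem elimination_mul_E_of_ne (hx : xᵀ = x) {j : Fin (r + 1)} (hjk : j ≠ k)
    (hdj : d j = 0) {a : ℝ} (hj : x * E j = a • E j) (t : ℝ) :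
    (1 + t • (E k * x * dg d))ᵀ * x * (1 + t • (E k * x * dg d)) * E j = a • E j := by
  have h0 : (dg d * E j : Mat r n) = 0 := by
    ext a b
    simp only [dg_mul_apply, E_apply, Matrix.zero_apply]
    grind
  have h1 : (1 + t • (E k * x * dg d)) * E j = E j := by
    rw [Matrix.add_mul, Matrix.smul_mul, Matrix.mul_assoc, h0]
    simp
  rw [Matrix.mul_assoc, h1, Matrix.mul_assoc, hj, Matrix.transpose_add, Matrix.transpose_smul,
    Matrix.transpose_mul, Matrix.transpose_mul, E_transpose, dg_transpose, hx,
    Matrix.transpose_one, Matrix.mul_smul, Matrix.add_mul, Matrix.smul_mul, Matrix.mul_assoc,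
    Matrix.mul_assoc, E_mul_E_of_ne hjk.symm]
  simp

end elimination

/-- If `η ∈ 𝒵` represents the same functional on `𝒵` as `m`, then it inherits scalar block columns
from `m`. -/
theorem mul_E_eq_of_tip_eq {η m : Mat r n} (hη : η ∈ Zspace V) (hm : mᵀ = m)
    (h : ∀ x ∈ Zspace V, tip η x = tip m x) {k : Fin (r + 1)} {c : ℝ} (hk : m * E k = c • E k) :
    η * E k = c • E k := by
  have hζ : η - c • E k ∈ Zsub V := (Zsub V).sub_mem hη ((Zsub V).smul_mem c (E_mem_Zsub k))
  set ζ := η - c • E k with hζd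
  have hk' : (m - c • E k) * E k = 0 := by
    rw [Matrix.sub_mul, hk, Matrix.smul_mul, E_mul_E_self, sub_self]
  have hk'' : E k * (m - c • E k) = 0 := by
    have := congrArg Matrix.transpose hk'
    simpa [E_transpose, hm] using this
  have h1 : tip ζ (E k * ζ + ζ * E k) = 0 := by
    rw [hζd, tip_sub_left, h _ (E_mul_add_mul_E_mem hζ k), ← tip_sub_left, tip, Matrix.mul_add,
      Matrix.trace_add, ← Matrix.mul_assoc, hk', Matrix.trace_mul_comm (m - c • E k), Matrix.mul_assoc,
      hk'']
    simp
  have h2 : tip (ζ * E k)ᵀ (ζ * E k) = 0 := by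
    have e1 : (ζ * (E k * ζ)).trace = ((ζ * E k)ᵀ * (ζ * E k)).trace := by
      rw [Matrix.transpose_mul, E_transpose, hζ.1.eq, Matrix.trace_mul_comm]
      calc _ = (E k * (ζ * ζ)).trace := by rw [Matrix.mul_assoc]
        _ = ((E k * E k) * (ζ * ζ)).trace := by rw [E_mul_E_self]
        _ = (E k * (E k * (ζ * ζ))).trace := by rw [Matrix.mul_assoc]
        _ = _ := by rw [Matrix.trace_mul_comm]; simp only [Matrix.mul_assoc]
    have e2 : (ζ * (ζ * E k)).trace = (ζ * (E k * ζ)).trace := by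
      rw [Matrix.trace_mul_comm, ← Matrix.mul_assoc]
    rw [tip, Matrix.mul_add, Matrix.trace_add, e2, e1] at h1
    rw [tip]
    linarith
  rw [tip_transpose_self, hζd, Matrix.sub_mul, Matrix.smul_mul, E_mul_E_self, sub_eq_zero] at h2
  exact h2

/-- An action `α` of `H` on a cone `C ⊆ 𝒵` with the features common to the action `ρ` on `𝒫` and
the adjoint action on `𝒬`; `e` is the order in which the block columns are eliminated. -/
structure IsConeAction (V : ∀ l k : Fin (r + 1), Submodule ℝ (Matrix (Fin (n l)) (Fin (n k)) ℝ))
    (C : Set (Mat r n)) (α : Mat r n → Mat r n → Mat r n)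
    (e : Fin (r + 1) ≃ Fin (r + 1)) : Prop where
  subset : C ⊆ Zspace V
  Pcone_subset : Pcone V ⊆ C
  pos : ∀ x ∈ C, ∀ k, ∀ c : ℝ, E k * x * E k = c • E k → 0 < c
  map_cone : ∀ T ∈ Hgrp V, ∀ x ∈ C, α T x ∈ C
  map_mem : ∀ T ∈ Hgrp V, ∀ x ∈ Zspace V, α T x ∈ Zspace V
  map_add_smul : ∀ T ∈ Hgrp V, ∀ x ∈ Zspace V, ∀ y ∈ Zspace V, ∀ t : ℝ,
    α T (x + t • y) = α T x + t • α T y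
  comp : ∀ T ∈ Hgrp V, ∀ S ∈ Hgrp V, ∃ R ∈ Hgrp V,
    (∀ s, chi s R = chi s T * chi s S) ∧ ∀ x ∈ Zspace V, α T (α S x) = α R x
  map_dg : ∀ d : Fin (r + 1) → ℝ, (∀ k, 0 < d k) → ∀ x ∈ Zspace V,
    α (dg d) x = dg d * x * dg d
  eliminate : ∀ k, ∀ x ∈ C, (∀ j, e j < e k → ∃ c : ℝ, x * E j = c • E j) →
    ∃ T ∈ Hgrp V, ∃ T' ∈ Hgrp V, α T' (α T x) = x ∧
      ∀ j, e j ≤ e k → ∃ c : ℝ, α T x * E j = c • E j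
  shear : ∀ k l, k < l → ∀ v ∈ Zspace V, v ≠ 0 → v = E l * v * E k + E k * v * E l →
    ∃ T ∈ Hgrp V, ∃ j, tip (α T v - v) (E j) ≠ 0

namespace IsConeAction

variable {C : Set (Mat r n)} {α : Mat r n → Mat r n → Mat r n} {e : Fin (r + 1) ≃ Fin (r + 1)}

theorem exists_eq_map_one_of_forall (h : IsConeAction V C α e) {x : Mat r n} (hx : x ∈ C)
    (hd : ∀ j, ∃ c : ℝ, x * E j = c • E j) : ∃ T ∈ Hgrp V, x = α T 1 := by
  choose c hc using hd
  have hpos : ∀ j, 0 < c j := fun j => h.pos x hx j (c j) <| by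
    rw [Matrix.mul_assoc, hc, Matrix.mul_smul, E_mul_E_self]
  refine ⟨dg fun j => √(c j), dg_mem_Hgrp fun j => Real.sqrt_pos.mpr (hpos j), ?_⟩
  rw [h.map_dg _ (fun j => Real.sqrt_pos.mpr (hpos j)) 1 one_mem_Pcone.1, Matrix.mul_one,
    dg_mul_dg]
  ext a b
  have := congrFun (congrFun (hc b.1) a) b
  simp only [mul_E_apply, if_true, Matrix.smul_apply, E_apply, smul_eq_mul] at this
  rw [this]
  simp only [dg, Matrix.diagonal_apply, Pi.mul_apply, Real.mul_self_sqrt (hpos _).le]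
  split_ifs with hab <;> simp [hab]

/-- `H` acts transitively on the cone. -/
theorem exists_eq_map_one (h : IsConeAction V C α e) {x : Mat r n} (hx : x ∈ C) :
    ∃ T ∈ Hgrp V, x = α T 1 := by
  suffices H : ∀ m ≤ r + 1, ∀ x ∈ C,
      (∀ j, (e j : ℕ) < r + 1 - m → ∃ c : ℝ, x * E j = c • E j) → ∃ T ∈ Hgrp V, x = α T 1 by
    exact H (r + 1) le_rfl x hx fun j hj => by omega
  intro m
  induction m with
  | zero => exact fun _ x hx hd => h.exists_eq_map_one_of_forall hx fun j => hd j (e j).2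
  | succ m ih =>
    intro hm x hx hd
    obtain ⟨k, hk⟩ : ∃ k, (e k : ℕ) = r + 1 - (m + 1) :=
      ⟨e.symm ⟨r + 1 - (m + 1), by omega⟩, by simp⟩
    obtain ⟨T, hT, T', hT', hTx, hcol⟩ := h.eliminate k x hx fun j hj => hd j (by
      rw [Fin.lt_def] at hj; omega)
    obtain ⟨S, hS, hS'⟩ := ih (by omega) _ (h.map_cone T hT x hx) fun j hj => hcol j (by
      rw [Fin.le_def]; omega)
    obtain ⟨R, hR, -, hR'⟩ := h.comp T' hT' S hS
    exact ⟨R, hR, by rw [← hR' 1 one_mem_Pcone.1, ← hS', hTx]⟩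

end IsConeAction

/-! ### Laplace transforms -/

theorem measurable_tip (v : Mat r n) : Measurable fun x : Mat r n => tip v x := by
  have h : ∀ p q : Idx r n, Measurable fun x : Mat r n => x p q := fun p q =>
    (measurable_pi_apply q).comp (measurable_pi_apply p)
  simp only [tip, Matrix.trace, Matrix.diag, Matrix.mul_apply]
  exact Finset.measurable_sum _ fun p _ => Finset.measurable_sum _ fun q _ => (h q p).const_mul _

theorem measurable_exp_neg_tip (v : Mat r n) :
    Measurable fun x : Mat r n => Real.exp (-(tip v x)) :=
  (measurable_tip v).neg.exp

/-- The equality case of the Cauchy–Schwarz inequality for Laplace transforms. -/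
theorem ae_tip_eq_zero_of_laplace_eq {μ : Measure (Mat r n)} {θ w : Mat r n} {L : ℝ≥0∞}
    (hL : L ≠ ∞) (h0 : laplace μ θ = L) (h1 : laplace μ (θ + w) = L)
    (h2 : laplace μ (θ + 2 • w) = L) : ∀ᵐ x ∂μ, tip w x = 0 := by
  have hm := measurable_exp_neg_tip (r := r) (n := n)
  set g : Mat r n → ℝ := fun x =>
    Real.exp (-(tip θ x)) * (1 - Real.exp (-(tip w x))) ^ 2 with hg
  have hgm : Measurable g := (hm θ).mul (((hm w).const_sub 1).pow_const 2)
  have hsum : ∀ x, ENNReal.ofReal (Real.exp (-(tip θ x))) +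
      ENNReal.ofReal (Real.exp (-(tip (θ + 2 • w) x))) =
      2 * ENNReal.ofReal (Real.exp (-(tip (θ + w) x))) + ENNReal.ofReal (g x) := fun x => by
    rw [← ENNReal.ofReal_ofNat 2, ← ENNReal.ofReal_mul (by norm_num),
      ← ENNReal.ofReal_add (by positivity) (by positivity),
      ← ENNReal.ofReal_add (by positivity) (by positivity), hg, two_smul]
    simp only [tip_add_left, neg_add, Real.exp_add]
    congr 1
    ring
  have hint : laplace μ θ + laplace μ (θ + 2 • w) =
      2 * laplace μ (θ + w) + ∫⁻ x, ENNReal.ofReal (g x) ∂μ := by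
    simp only [laplace]
    rw [← lintegral_add_left (hm _).ennreal_ofReal, ← lintegral_const_mul _
      (hm _).ennreal_ofReal, ← lintegral_add_left ((hm _).ennreal_ofReal.const_mul _)]
    exact lintegral_congr hsum
  rw [h0, h1, h2, ← two_mul] at hint
  have hz : ∫⁻ x, ENNReal.ofReal (g x) ∂μ = 0 := by
    have h2L : 2 * L ≠ ∞ := ENNReal.mul_ne_top (by simp) hL
    exact (ENNReal.add_right_inj h2L).mp (by rw [← hint, add_zero])
  rw [lintegral_eq_zero_iff hgm.ennreal_ofReal] at hz
  filter_upwards [hz] with x hx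
  simp only [Pi.zero_apply, ENNReal.ofReal_eq_zero] at hx
  have h3 : (1 - Real.exp (-(tip w x))) ^ 2 ≤ 0 :=
    nonpos_of_mul_nonpos_right hx (Real.exp_pos _)
  have h4 : Real.exp (-(tip w x)) = 1 := by nlinarith
  simpa using h4

theorem laplace_add_smul_of_ae {μ : Measure (Mat r n)} {v : Mat r n} {c : ℝ}
    (hv : ∀ᵐ x ∂μ, tip v x = c) (θ : Mat r n) (t : ℝ) :
    laplace μ (θ + t • v) = ENNReal.ofReal (Real.exp (-(t * c))) * laplace μ θ := by
  rw [laplace, laplace, ← lintegral_const_mul _ (measurable_exp_neg_tip θ).ennreal_ofReal]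
  refine lintegral_congr_ae ?_
  filter_upwards [hv] with x hx
  rw [tip_add_left, tip_smul_left, hx, ← ENNReal.ofReal_mul (Real.exp_pos _).le, ← Real.exp_add]
  congr 2
  ring

namespace IsConeAction

variable {C : Set (Mat r n)} {α : Mat r n → Mat r n → Mat r n} {e : Fin (r + 1) ≃ Fin (r + 1)}
  {μ : Measure (Mat r n)} {s : Fin (r + 1) → ℝ}

theorem map_one_dg (h : IsConeAction V C α e) {d : Fin (r + 1) → ℝ} (hd : ∀ k, 0 < d k) :
    α (dg d) 1 = dg (d * d) := by
  rw [h.map_dg d hd 1 one_mem_Pcone.1, Matrix.mul_one, dg_mul_dg]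

theorem laplace_dg (h : IsConeAction V C α e)
    (hL : ∀ T ∈ Hgrp V, laplace μ (α T 1) = ENNReal.ofReal (chi (-s) T))
    {d : Fin (r + 1) → ℝ} (hd : ∀ k, 0 < d k) :
    laplace μ (dg (d * d)) = ENNReal.ofReal (∏ k, d k ^ (2 * (-s) k)) := by
  rw [← h.map_one_dg hd, hL _ (dg_mem_Hgrp hd), chi_dg]

theorem laplace_one (h : IsConeAction V C α e)
    (hL : ∀ T ∈ Hgrp V, laplace μ (α T 1) = ENNReal.ofReal (chi (-s) T)) :
    laplace μ 1 = 1 := by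
  have := h.laplace_dg hL (d := 1) (by simp)
  rw [mul_one, ← one_eq_dg] at this
  simpa using this

theorem laplace_one_add_smul_E (h : IsConeAction V C α e)
    (hL : ∀ T ∈ Hgrp V, laplace μ (α T 1) = ENNReal.ofReal (chi (-s) T)) (k : Fin (r + 1))
    {a : ℝ} (ha : 0 < 1 + a) :
    laplace μ (1 + (a * (2 + a)) • E k) = ENNReal.ofReal ((1 + a) ^ (-(2 * s k))) := by
  have hd : ∀ j, 0 < (1 + Pi.single k a : Fin (r + 1) → ℝ) j := fun j => by
    by_cases hj : j = k
    · subst hj; simpa using ha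
    · simp [hj]
  have h1 := h.laplace_dg hL hd
  have h2 : (1 + Pi.single k a : Fin (r + 1) → ℝ) * (1 + Pi.single k a) =
      1 + Pi.single k (a * (2 + a)) := by
    ext j
    by_cases hj : j = k
    · subst hj; simp; ring
    · simp [hj]
  rw [h2, dg_one_add_single, Finset.prod_eq_single k (fun j _ hj => by simp [hj]) (by simp)] at h1
  simpa using h1

theorem laplace_map (h : IsConeAction V C α e)
    (hL : ∀ T ∈ Hgrp V, laplace μ (α T 1) = ENNReal.ofReal (chi (-s) T)) {T θ : Mat r n}
    (hT : T ∈ Hgrp V) (hθ : θ ∈ C) :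
    laplace μ (α T θ) = ENNReal.ofReal (chi (-s) T) * laplace μ θ := by
  obtain ⟨S, hS, rfl⟩ := h.exists_eq_map_one hθ
  obtain ⟨R, hR, hchi, hR'⟩ := h.comp T hT S hS
  rw [hR' 1 one_mem_Pcone.1, hL R hR, hL S hS, hchi, ENNReal.ofReal_mul (chi_pos _ hT).le]

theorem exists_one_add_smul_mem (h : IsConeAction V C α e) {v : Mat r n} (hv : v ∈ Zspace V) :
    ∃ ε > 0, ∀ t : ℝ, |t| ≤ ε → 1 + t • v ∈ C := by
  obtain ⟨ε, hε, H⟩ := exists_posDef_one_add_smul hv.1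
  exact ⟨ε, hε, fun t ht => h.Pcone_subset
    ⟨(Zsub V).add_mem one_mem_Pcone.1 ((Zsub V).smul_mem t hv), H t ht⟩⟩

/-- A functional which is almost everywhere constant vanishes almost everywhere. -/
theorem const_eq_zero (h : IsConeAction V C α e)
    (hL : ∀ T ∈ Hgrp V, laplace μ (α T 1) = ENNReal.ofReal (chi (-s) T)) {v : Mat r n}
    (hv : v ∈ Zspace V) {c : ℝ} (hc : ∀ᵐ x ∂μ, tip v x = c) : c = 0 := by
  obtain ⟨ε, hε, hC⟩ := h.exists_one_add_smul_mem hv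
  have hd : ∀ k : Fin (r + 1), 0 < (fun _ => 2 : Fin (r + 1) → ℝ) k := fun _ => two_pos
  have hD : (dg fun _ => 2 : Mat r n) ∈ Hgrp V := dg_mem_Hgrp hd
  have hdg : (dg fun _ => 2 : Mat r n) = (2 : ℝ) • 1 := by
    ext a b; simp [dg, Matrix.diagonal_apply, Matrix.one_apply]
  have hv4 : α (dg fun _ => 2) v = (4 : ℝ) • v := by
    rw [h.map_dg _ hd v hv, hdg]
    simp only [Matrix.smul_mul, Matrix.mul_smul, Matrix.one_mul, Matrix.mul_one, smul_smul]
    norm_num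
  have h1 := h.laplace_map hL hD (hC ε (abs_of_pos hε).le)
  rw [h.map_add_smul _ hD 1 one_mem_Pcone.1 v hv, hv4, smul_smul, laplace_add_smul_of_ae hc,
    laplace_add_smul_of_ae hc, hL _ hD, h.laplace_one hL, mul_one, mul_comm,
    ENNReal.mul_right_inj (by simpa using chi_pos _ hD) ENNReal.ofReal_ne_top,
    ENNReal.ofReal_eq_ofReal_iff (Real.exp_pos _).le (Real.exp_pos _).le, Real.exp_eq_exp] at h1
  have : ε * c = 0 := by linarith
  exact (mul_eq_zero.mp this).resolve_left hε.ne'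

/-- The functionals vanishing almost everywhere form an `H`-invariant space. -/
theorem ae_tip_map_eq_zero (h : IsConeAction V C α e)
    (hL : ∀ T ∈ Hgrp V, laplace μ (α T 1) = ENNReal.ofReal (chi (-s) T)) {v T : Mat r n}
    (hT : T ∈ Hgrp V) (hv : v ∈ Zspace V) (hc : ∀ᵐ x ∂μ, tip v x = 0) :
    ∀ᵐ x ∂μ, tip (α T v) x = 0 := by
  obtain ⟨ε, hε, hC⟩ := h.exists_one_add_smul_mem hv
  have key : ∀ t : ℝ, |t| ≤ ε →
      laplace μ (α T 1 + t • α T v) = ENNReal.ofReal (chi (-s) T) := fun t ht => by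
    rw [← h.map_add_smul T hT 1 one_mem_Pcone.1 v hv, h.laplace_map hL hT (hC t ht),
      laplace_add_smul_of_ae hc, h.laplace_one hL]
    simp
  have h1 : ∀ᵐ x ∂μ, tip (ε • α T v) x = 0 := by
    refine ae_tip_eq_zero_of_laplace_eq (θ := α T 1 + (-ε) • α T v)
      (L := ENNReal.ofReal (chi (-s) T)) ENNReal.ofReal_ne_top
      (key _ (by rw [abs_neg, abs_of_pos hε])) ?_ ?_
    · convert key 0 (by simpa using hε.le) using 2
      module
    · convert key ε (abs_of_pos hε).le using 2
      module
  filter_upwards [h1] with x hx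
  rw [tip_smul_left] at hx
  exact (mul_eq_zero.mp hx).resolve_left hε.ne'

theorem ae_tip_E_components (h : IsConeAction V C α e)
    (hL : ∀ T ∈ Hgrp V, laplace μ (α T 1) = ENNReal.ofReal (chi (-s) T)) {v : Mat r n}
    (hv : v ∈ Zspace V) (hc : ∀ᵐ x ∂μ, tip v x = 0) (k : Fin (r + 1)) :
    (∀ᵐ x ∂μ, tip (E k * v + v * E k) x = 0) ∧ ∀ᵐ x ∂μ, tip (E k * v * E k) x = 0 := by
  have key : ∀ t : ℝ, 0 < t → ∀ᵐ x ∂μ,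
      tip v x + t * tip (E k * v + v * E k) x + t ^ 2 * tip (E k * v * E k) x = 0 := fun t ht => by
    have hd : ∀ j, 0 < (1 + Pi.single k t : Fin (r + 1) → ℝ) j := fun j => by
      by_cases hj : j = k
      · subst hj; simp; positivity
      · simp [hj]
    have h1 := h.ae_tip_map_eq_zero hL (dg_mem_Hgrp hd) hv hc
    rw [h.map_dg _ hd v hv, dg_one_add_single] at h1
    filter_upwards [h1] with x hx
    rw [← hx, ← tip_smul_left, ← tip_smul_left, ← tip_add_left, ← tip_add_left]
    congr 1
    simp only [Matrix.add_mul, Matrix.mul_add, Matrix.one_mul, Matrix.mul_one, Matrix.smul_mul,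
      Matrix.mul_smul]
    module
  constructor <;> filter_upwards [hc, key 1 one_pos, key 2 two_pos] with x h0 h1 h2 <;> linarith

theorem not_ae_tip_E (h : IsConeAction V C α e)
    (hL : ∀ T ∈ Hgrp V, laplace μ (α T 1) = ENNReal.ofReal (chi (-s) T)) {k : Fin (r + 1)}
    (hs : 0 < s k) : ¬ ∀ᵐ x ∂μ, tip (E k) x = 0 := fun hE => by
  have h1 := h.laplace_one_add_smul_E hL k (a := 1) (by norm_num)
  rw [laplace_add_smul_of_ae hE, h.laplace_one hL] at h1
  have h2 : (1 + 1 : ℝ) ^ (-(2 * s k)) < 1 :=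
    Real.rpow_lt_one_of_one_lt_of_neg (by norm_num) (by linarith)
  have h3 := ENNReal.ofReal_lt_one.mpr h2
  rw [← h1] at h3
  simp at h3

theorem tip_E_eq_zero (h : IsConeAction V C α e)
    (hL : ∀ T ∈ Hgrp V, laplace μ (α T 1) = ENNReal.ofReal (chi (-s) T)) {v : Mat r n}
    (hv : v ∈ Zspace V) (hc : ∀ᵐ x ∂μ, tip v x = 0) {k : Fin (r + 1)} (hs : 0 < s k) :
    E k * v * E k = 0 := by
  obtain ⟨c, hck⟩ := exists_E_mul_mul_E_eq hv k
  have h1 := (h.ae_tip_E_components hL hv hc k).2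
  rw [hck] at h1 ⊢
  by_contra hne
  have hc0 : c ≠ 0 := fun h => hne (by simp [h])
  refine h.not_ae_tip_E hL hs ?_
  filter_upwards [h1] with x hx
  rw [tip_smul_left] at hx
  exact (mul_eq_zero.mp hx).resolve_left hc0

theorem eq_zero_of_ae_tip_eq_zero (h : IsConeAction V C α e)
    (hL : ∀ T ∈ Hgrp V, laplace μ (α T 1) = ENNReal.ofReal (chi (-s) T))
    (hs : ∀ k, 0 < s k) {v : Mat r n} (hv : v ∈ Zspace V) (hc : ∀ᵐ x ∂μ, tip v x = 0) :
    v = 0 := by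
  have hoff : ∀ k l, k < l → E l * v * E k + E k * v * E l = 0 := fun k l hkl => by
    have h1 := (h.ae_tip_E_components hL hv hc k).1
    have hZ1 := E_mul_add_mul_E_mem hv k
    have h2 := (h.ae_tip_E_components hL hZ1 h1 l).1
    have hZ2 := E_mul_add_mul_E_mem hZ1 l
    have ew : E l * (E k * v + v * E k) + (E k * v + v * E k) * E l =
        E l * v * E k + E k * v * E l := by
      rw [Matrix.mul_add, Matrix.add_mul, ← Matrix.mul_assoc, E_mul_E_of_ne hkl.ne',
        Matrix.mul_assoc v, E_mul_E_of_ne hkl.ne]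
      simp [Matrix.mul_assoc]
    rw [ew] at h2 hZ2
    by_contra hne
    obtain ⟨T, hT, j, hj⟩ := h.shear k l hkl _ hZ2 hne (by
      ext a b
      simp only [Matrix.add_apply, mul_E_apply, E_mul_apply]
      grind)
    have h3 := h.ae_tip_map_eq_zero hL hT hZ2 h2
    refine hj ?_
    rw [tip_E, h.tip_E_eq_zero hL ((Zsub V).sub_mem (h.map_mem T hT _ hZ2) hZ2) ?_ (hs j),
      Matrix.trace_zero]
    filter_upwards [h2, h3] with x hx hx'
    rw [tip_sub_left, hx, hx', sub_zero]
  ext a b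
  rcases lt_trichotomy a.1 b.1 with hab | hab | hab
  · simpa [mul_E_apply, E_mul_apply, hab.ne, hab.ne'] using
      congrFun (congrFun (hoff _ _ hab) a) b
  · simpa [mul_E_apply, E_mul_apply, hab] using
      congrFun (congrFun (h.tip_E_eq_zero hL hv hc (hs a.1)) a) b
  · simpa [mul_E_apply, E_mul_apply, hab.ne, hab.ne'] using
      congrFun (congrFun (hoff _ _ hab) a) b

theorem not_concentrated_iff (h : IsConeAction V C α e)
    (hL : ∀ T ∈ Hgrp V, laplace μ (α T 1) = ENNReal.ofReal (chi (-s) T))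
    (hsupp : μ (Zspace V)ᶜ = 0) (hs : ∀ k, 0 ≤ s k) :
    (∀ (f : Mat r n →ₗ[ℝ] ℝ) (c : ℝ), (∃ x ∈ Zspace V, f x ≠ 0) → μ {x | f x = c}ᶜ ≠ 0) ↔
      ∀ k, 0 < s k := by
  constructor
  · intro H k
    by_contra hk
    have hk0 : s k = 0 := le_antisymm (not_lt.mp hk) (hs k)
    have hae : ∀ᵐ x ∂μ, tip ((24 : ℝ) • E k) x = 0 := by
      refine ae_tip_eq_zero_of_laplace_eq (θ := 1) (L := 1) (by simp) (h.laplace_one hL) ?_ ?_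
      · have := h.laplace_one_add_smul_E hL k (a := 4) (by norm_num)
        rw [hk0] at this
        norm_num at this
        exact this
      · have := h.laplace_one_add_smul_E hL k (a := 6) (by norm_num)
        rw [hk0] at this
        norm_num at this
        rw [← this]
        congr 2
        module
    refine H (IsLinearMap.mk' (tip ((24 : ℝ) • E k))
      ⟨fun x y => tip_add_right _ _ _, fun c x => tip_smul_right _ _ _⟩) 0
      ⟨E k, E_mem_Zsub k, ?_⟩ (mem_ae_iff.mp hae)
    have h1 : tip (E k : Mat r n) (E k) ≠ 0 := fun h0 => E_ne_zero (n := n) k <| by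
      rw [← tip_transpose_self, E_transpose, h0]
    simpa [tip_smul_left] using h1
  · rintro H f c ⟨x₀, hx₀, hfx₀⟩ hμ
    obtain ⟨v, hv, hfv⟩ := exists_tip_eq (V := V) f
    have hae : ∀ᵐ x ∂μ, tip v x = c := by
      have h1 : ∀ᵐ x ∂μ, f x = c := mem_ae_iff.mpr hμ
      have h2 : ∀ᵐ x ∂μ, x ∈ Zspace V := mem_ae_iff.mpr hsupp
      filter_upwards [h1, h2] with x hx hxZ
      rw [← hfv x hxZ, hx]
    have hc := h.const_eq_zero hL hv hae
    subst hc
    refine hfx₀ ?_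
    rw [hfv x₀ hx₀, h.eq_zero_of_ae_tip_eq_zero hL H hv hae]
    simp [tip]

end IsConeAction

/-! ### The two cones -/

theorem one_add_mul_add_transpose_mul {L : Mat r n} (hL : L * L = 0) :
    (1 + L) * (L + Lᵀ) * (1 + Lᵀ) = L + Lᵀ + (2 : ℝ) • (L * Lᵀ) := by
  have hL' : Lᵀ * Lᵀ = 0 := by rw [← Matrix.transpose_mul, hL, Matrix.transpose_zero]
  simp only [Matrix.add_mul, Matrix.mul_add, Matrix.one_mul, Matrix.mul_one, Matrix.mul_assoc, hL,
    hL', Matrix.mul_zero, two_smul]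
  simp only [Matrix.zero_mul]
  abel

theorem E_shear {k l : Fin (r + 1)} (hkl : k < l) {v : Mat r n} (hv : v ∈ Zspace V)
    (hv0 : v ≠ 0) (hvkl : v = E l * v * E k + E k * v * E l) :
    ∃ L : Mat r n, 1 + L ∈ Hgrp V ∧ L * L = 0 ∧ v = L + Lᵀ ∧ L * E k = L ∧ Lᵀ * E l = Lᵀ ∧
      L ≠ 0 := by
  have ht : (E l * v * E k)ᵀ = E k * v * E l := by
    simp [E_transpose, hv.1.eq, Matrix.mul_assoc]
  refine ⟨E l * v * E k, ?_, ?_, ?_, ?_, ?_, fun h => hv0 ?_⟩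
  · have := one_add_smul_mem_Hgrp hv (d := Pi.single l 1) (d' := Pi.single k 1)
      (fun i j hij => by
        simp only [Pi.single_apply]
        grind) 1
    rwa [one_smul] at this
  · calc _ = E l * v * (E k * E l) * v * E k := by simp only [Matrix.mul_assoc]
      _ = 0 := by rw [E_mul_E_of_ne hkl.ne]; simp
  · rw [ht]; exact hvkl
  · rw [Matrix.mul_assoc, E_mul_E_self]
  · rw [ht, Matrix.mul_assoc, E_mul_E_self]
  · rw [hvkl, ← ht, h]
    simp

theorem rhoM_rhoM (T S x : Mat r n) : rhoM T (rhoM S x) = rhoM (T * S) x := by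
  simp only [rhoM, Matrix.transpose_mul, Matrix.mul_assoc]

theorem tip_pos_of_mem_closure {y x : Mat r n} (hy : y.PosDef) (hx : x ∈ closure (Pcone V))
    (hx0 : x ≠ 0) : 0 < tip y x :=
  trace_mul_pos_of_posDef hy
    (closure_minimal (fun _ h => h.2.posSemidef) isClosed_setOf_posSemidef hx) hx0

theorem Pcone_subset_Qcone : Pcone V ⊆ Qcone V := fun _ hy =>
  ⟨hy.1, fun _ hx hx0 => tip_pos_of_mem_closure hy.2 hx hx0⟩

theorem E_mem_closure_Pcone (k : Fin (r + 1)) : (E k : Mat r n) ∈ closure (Pcone V) := by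
  have hc : Filter.Tendsto (fun t : ℝ => (E k + t • 1 : Mat r n)) (nhdsWithin 0 (Set.Ioi 0))
      (nhds (E k)) := by
    have : Continuous fun t : ℝ => (E k + t • 1 : Mat r n) := by fun_prop
    simpa using (this.tendsto 0).mono_left nhdsWithin_le_nhds
  refine mem_closure_of_tendsto hc ?_
  filter_upwards [self_mem_nhdsWithin] with t ht
  refine ⟨(Zsub V).add_mem (E_mem_Zsub k) ((Zsub V).smul_mem t one_mem_Pcone.1), ?_⟩
  have hE : (E k : Mat r n).PosSemidef := by
    simpa [E_transpose, E_mul_E_self] using Matrix.posSemidef_conjTranspose_mul_self (E k : Mat r n)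
  exact Matrix.PosDef.posSemidef_add hE (Matrix.PosDef.one.smul ht)

theorem closure_Pcone_subset : closure (Pcone V) ⊆ Zspace V :=
  closure_minimal (fun _ h => h.1) (Submodule.closed_of_finiteDimensional (Zsub V))

theorem isConeAction_rhoM (hV1 : CondV1 V) (hV2 : CondV2 V) (hV3 : CondV3 V) :
    IsConeAction V (Pcone V) rhoM (Equiv.refl _) := by
  have hpos : ∀ x ∈ Pcone V, ∀ k, ∀ c : ℝ, E k * x * E k = c • E k → 0 < c := by
    intro x hx k c hc
    have h := congrFun (congrFun hc ⟨k, ⟨0, (n k).2⟩⟩) ⟨k, ⟨0, (n k).2⟩⟩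
    simp only [mul_E_apply, E_mul_apply, Matrix.smul_apply, E_apply, if_true, smul_eq_mul,
      mul_one] at h
    rw [← h]
    exact hx.2.diag_pos
  refine ⟨fun x hx => hx.1, subset_rfl, hpos, fun T hT x hx => rhoM_mem_Pcone hV1 hV2 hV3 hT hx,
    fun T hT x hx => rhoM_mem_Zsub hV1 hV2 hV3 hT hx, fun T hT x hx y hy t => ?_,
    fun T hT S hS => ⟨T * S, mul_mem_Hgrp hV1 hT hS, fun s => chi_mul s hT hS, fun x hx =>
      rhoM_rhoM T S x⟩, fun d hd x hx => by rw [rhoM, dg_transpose],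
    fun k x hx hcol => ?_, fun k l hkl v hv hv0 hvkl => ?_⟩
  · simp [rhoM, Matrix.mul_add, Matrix.add_mul]
  · obtain ⟨c, hc⟩ := exists_E_mul_mul_E_eq hx.1 k
    have hc0 := hpos x hx k c hc
    set d : Fin (r + 1) → ℝ := fun j => if k < j then 1 else 0 with hd
    have hT : (1 + (-c⁻¹) • (E k * x * dg d))ᵀ = 1 + (-c⁻¹) • (dg d * x * E k) := by
      simp [E_transpose, dg_transpose, hx.1.1.eq, Matrix.mul_assoc]
    have hrho : rhoM (1 + (-c⁻¹) • (dg d * x * E k)) x =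
        (1 + (-c⁻¹) • (E k * x * dg d))ᵀ * x * (1 + (-c⁻¹) • (E k * x * dg d)) := by
      rw [rhoM, ← hT, Matrix.transpose_transpose]
    have hdk : ∀ l j, l ≤ j → d l * (Pi.single k 1 : Fin (r + 1) → ℝ) j = 0 := by
      intro l j hlj
      simp only [hd, Pi.single_apply]
      grind
    refine ⟨_, one_add_smul_mem_Hgrp hx.1 hdk (-c⁻¹), _, one_add_smul_mem_Hgrp hx.1 hdk c⁻¹,
      ?_, fun j hj => ?_⟩
    · rw [rhoM_rhoM, one_add_smul_mul_one_add_smul (by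
        ext j
        simp only [hd, Pi.mul_apply, Pi.single_apply, Pi.zero_apply]
        grind), rhoM]
      simp
    · change ∃ b : ℝ, rhoM (1 + (-c⁻¹) • (dg d * x * E k)) x * E j = b • E j
      rw [hrho]
      rcases eq_or_lt_of_le (show j ≤ k from hj) with rfl | hjk
      · refine ⟨c, elimination_mul_E hx.1.1 hc0.ne' hc (by simp [hd]) fun i hi => ?_⟩
        rcases lt_or_gt_of_ne hi with h | h
        · exact .inr (hcol i h)
        · exact .inl (by simp [hd, h])
      · obtain ⟨b, hb⟩ := hcol j hjk
        exact ⟨b, elimination_mul_E_of_ne hx.1.1 hjk.ne (by simp [hd, hjk.le]) hb _⟩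
  · obtain ⟨L, hLH, hL2, rfl, -, hLl, hL0⟩ := E_shear hkl hv hv0 hvkl
    refine ⟨1 + L, hLH, l, ?_⟩
    rw [rhoM, Matrix.transpose_add, Matrix.transpose_one, one_add_mul_add_transpose_mul hL2,
      add_sub_cancel_left, tip_smul_left, tip, Matrix.mul_assoc, hLl, Matrix.trace_mul_comm]
    exact mul_ne_zero two_ne_zero fun h => hL0 ((tip_transpose_self L).mp h)

theorem isConeAction_rstar (hV1 : CondV1 V) (hV2 : CondV2 V) (hV3 : CondV3 V)
    {rstar : Mat r n → Mat r n → Mat r n}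
    (hrstar : ∀ T ∈ Hgrp V, ∀ ξ ∈ Zspace V, rstar T ξ ∈ Zspace V ∧
      ∀ x ∈ Zspace V, tip (rstar T ξ) x = tip ξ (rhoM T x)) :
    IsConeAction V (Qcone V) rstar Fin.revPerm := by
  have hmem : ∀ T ∈ Hgrp V, ∀ x ∈ Zspace V, rstar T x ∈ Zspace V := fun T hT x hx =>
    (hrstar T hT x hx).1
  have htip : ∀ T ∈ Hgrp V, ∀ x ∈ Zspace V, ∀ z ∈ Zspace V,
      tip (rstar T x) z = tip (Tᵀ * x * T) z := fun T hT x hx z hz => by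
    rw [(hrstar T hT x hx).2 z hz, tip_rhoM]
  have hcomp : ∀ T ∈ Hgrp V, ∀ S ∈ Hgrp V, ∀ x ∈ Zspace V,
      rstar T (rstar S x) = rstar (S * T) x := fun T hT S hS x hx => by
    refine tip_ext (hmem T hT _ (hmem S hS x hx)) (hmem _ (mul_mem_Hgrp hV1 hS hT) x hx)
      fun z hz => ?_
    rw [(hrstar T hT _ (hmem S hS x hx)).2 z hz,
      (hrstar S hS x hx).2 _ (rhoM_mem_Zsub hV1 hV2 hV3 hT hz), rhoM_rhoM,
      (hrstar _ (mul_mem_Hgrp hV1 hS hT) x hx).2 z hz]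
  have hdg : ∀ d : Fin (r + 1) → ℝ, (∀ k, 0 < d k) → ∀ x ∈ Zspace V,
      rstar (dg d) x = dg d * x * dg d := fun d hd x hx => by
    refine tip_ext (hmem _ (dg_mem_Hgrp hd) x hx) (dg_mul_mul_dg_mem hx d) fun z hz => ?_
    rw [htip _ (dg_mem_Hgrp hd) x hx z hz, dg_transpose]
  have hpos : ∀ x ∈ Qcone V, ∀ k, ∀ c : ℝ, E k * x * E k = c • E k → 0 < c := by
    intro x hx k c hc
    have h1 := hx.2 _ (E_mem_closure_Pcone k) (E_ne_zero k)
    rw [tip_E, hc, Matrix.trace_smul, smul_eq_mul] at h1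
    refine pos_of_mul_pos_left h1 (Finset.sum_nonneg fun a _ => ?_)
    simp only [Matrix.diag_apply, E_apply]
    split_ifs <;> norm_num
  refine ⟨fun x hx => hx.1, Pcone_subset_Qcone, hpos, fun T hT x hx => ⟨hmem T hT x hx.1,
    fun y hy hy0 => ?_⟩, hmem, fun T hT x hx y hy t => ?_,
    fun T hT S hS => ⟨S * T, mul_mem_Hgrp hV1 hS hT, fun s => ?_, hcomp T hT S hS⟩, hdg,
    fun k x hx hcol => ?_, fun k l hkl v hv hv0 hvkl => ?_⟩
  · rw [(hrstar T hT x hx.1).2 y (closure_Pcone_subset hy)]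
    refine hx.2 _ ?_ fun h => hy0 ?_
    · exact map_mem_closure (f := rhoM T) (by unfold rhoM; fun_prop) hy
        fun z hz => rhoM_mem_Pcone hV1 hV2 hV3 hT hz
    · have hT' := isUnit_of_mem_Hgrp hT
      have hT'' : IsUnit Tᵀ := by
        rw [Matrix.isUnit_iff_isUnit_det] at hT' ⊢
        rwa [Matrix.det_transpose]
      have h1 : T * y = 0 := hT''.mul_right_cancel (by rw [Matrix.zero_mul]; exact h)
      exact hT'.mul_left_cancel (by rw [h1, Matrix.mul_zero])
  · have hxy : x + t • y ∈ Zsub V := (Zsub V).add_mem hx ((Zsub V).smul_mem t hy)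
    refine tip_ext (hmem T hT _ hxy)
      ((Zsub V).add_mem (hmem T hT x hx) ((Zsub V).smul_mem t (hmem T hT y hy))) fun z hz => ?_
    rw [(hrstar T hT _ hxy).2 z hz, tip_add_left, tip_add_left, tip_smul_left, tip_smul_left,
      (hrstar T hT x hx).2 z hz, (hrstar T hT y hy).2 z hz]
  · rw [chi_mul s hS hT, mul_comm]
  · obtain ⟨c, hc⟩ := exists_E_mul_mul_E_eq hx.1 k
    have hc0 := hpos x hx k c hc
    set d : Fin (r + 1) → ℝ := fun j => if j < k then 1 else 0 with hd
    have hdk : ∀ l j, l ≤ j → (Pi.single k 1 : Fin (r + 1) → ℝ) l * d j = 0 := by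
      intro l j hlj
      simp only [hd, Pi.single_apply]
      grind
    have hT := one_add_smul_mem_Hgrp hx.1 hdk (-c⁻¹)
    have hT' := one_add_smul_mem_Hgrp hx.1 hdk (-(-c⁻¹))
    refine ⟨_, hT, _, hT', ?_, fun j hj => ?_⟩
    · rw [hcomp _ hT' _ hT x hx.1,
        one_add_smul_mul_one_add_smul (by
        ext j
        simp only [hd, Pi.mul_apply, Pi.single_apply, Pi.zero_apply]
        grind), one_eq_dg,
        hdg _ (by simp) x hx.1, ← one_eq_dg]
      simp
    · have hsymm : ((1 + (-c⁻¹) • (E k * x * dg d))ᵀ * x *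
          (1 + (-c⁻¹) • (E k * x * dg d)))ᵀ =
          (1 + (-c⁻¹) • (E k * x * dg d))ᵀ * x * (1 + (-c⁻¹) • (E k * x * dg d)) := by
        rw [Matrix.transpose_mul, Matrix.transpose_mul, Matrix.transpose_transpose, hx.1.1.eq]
        exact (Matrix.mul_assoc _ _ _).symm
      have hjk' : k ≤ j := by simpa using hj
      rcases eq_or_lt_of_le hjk' with rfl | hjk
      · refine ⟨c, mul_E_eq_of_tip_eq (hmem _ hT x hx.1) hsymm (htip _ hT x hx.1)
          (elimination_mul_E hx.1.1 hc0.ne' hc (by simp [hd]) fun i hi => ?_)⟩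
        rcases lt_or_gt_of_ne hi with h | h
        · exact .inl (by simp [hd, h])
        · exact .inr (hcol i (by simpa using h))
      · obtain ⟨b, hb⟩ := hcol j (by simpa using hjk)
        exact ⟨b, mul_E_eq_of_tip_eq (hmem _ hT x hx.1) hsymm (htip _ hT x hx.1)
          (elimination_mul_E_of_ne hx.1.1 hjk.ne' (by simp [hd, hjk.le]) hb _)⟩
  · obtain ⟨L, hLH, hL2, hvL, hLk, -, hL0⟩ := E_shear hkl hv hv0 hvkl
    refine ⟨1 + L, hLH, k, ?_⟩
    have hL2' : Lᵀ * Lᵀ = 0 := by rw [← Matrix.transpose_mul, hL2, Matrix.transpose_zero]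
    have h1 := one_add_mul_add_transpose_mul hL2'
    rw [Matrix.transpose_transpose, add_comm Lᵀ L, ← hvL] at h1
    rw [tip_sub_left, htip _ hLH v hv _ (E_mem_Zsub k), ← tip_sub_left, Matrix.transpose_add,
      Matrix.transpose_one, h1, add_sub_cancel_left, tip_smul_left, tip, Matrix.mul_assoc, hLk]
    exact mul_ne_zero two_ne_zero fun h => hL0 ((tip_transpose_self L).mp h)

theorem nonneg_of_mem_XiSet {s : Fin (r + 1) → ℝ} (hs : s ∈ XiSet V) (k : Fin (r + 1)) :
    0 ≤ s k := by
  obtain ⟨ε, hε⟩ := Set.mem_iUnion.mp hs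
  have h0 : 0 ≤ xiBound V ε k := by unfold xiBound; positivity
  cases h : ε k with
  | true => exact h0.trans ((hε k).1 h).le
  | false => exact h0.trans ((hε k).2 h).ge

theorem nonneg_of_mem_frakX {s : Fin (r + 1) → ℝ} (hs : s ∈ frakX V) (k : Fin (r + 1)) :
    0 ≤ s k := by
  obtain ⟨ε, hε⟩ := Set.mem_iUnion.mp hs
  have h0 : 0 ≤ frakBound V ε k := by unfold frakBound; positivity
  cases h : ε k with
  | true => exact h0.trans ((hε k).1 h).le
  | false => exact h0.trans ((hε k).2 h).ge

/-- (i) Let `s ∈ Ξ` and `R_s` a positive measure on `𝒵` with Laplace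
transform `δ_{-s}` on `𝒬`.  Then `R_s` is not concentrated on any affine hyperplane of `𝒵`
iff `s_k > 0` for all `k`.  (ii) The analogous statement for `s' ∈ 𝔛` and the measure
`R*_{s'}` with Laplace transform `Δ_{-s'}` on `𝒫`. -/
theorem statement6 (r : ℕ) (n : Fin (r + 1) → ℕ+)
    (V : ∀ l k : Fin (r + 1), Submodule ℝ (Matrix (Fin (n l)) (Fin (n k)) ℝ))
    (hV1 : CondV1 V) (hV2 : CondV2 V) (hV3 : CondV3 V)
    (rstar : Mat r n → Mat r n → Mat r n)
    (hrstar : ∀ T ∈ Hgrp V, ∀ ξ ∈ Zspace V, rstar T ξ ∈ Zspace V ∧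
      ∀ x ∈ Zspace V, tip (rstar T ξ) x = tip ξ (rhoM T x))
    (δf : (Fin (r + 1) → ℝ) → Mat r n → ℝ)
    (hδ : ∀ s : Fin (r + 1) → ℝ, ∀ T ∈ Hgrp V, δf s (rstar T 1) = chi s T)
    (Δf : (Fin (r + 1) → ℝ) → Mat r n → ℝ)
    (hΔ : ∀ s : Fin (r + 1) → ℝ, ∀ T ∈ Hgrp V, Δf s (rhoM T 1) = chi s T)
    (s : Fin (r + 1) → ℝ) (hs : s ∈ XiSet V)
    (μ : Measure (Mat r n)) (hμsupp : μ (Zspace V)ᶜ = 0)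
    (hμL : ∀ ξ ∈ Qcone V, laplace μ ξ = ENNReal.ofReal (δf (-s) ξ))
    (s' : Fin (r + 1) → ℝ) (hs' : s' ∈ frakX V)
    (μ' : Measure (Mat r n)) (hμ'supp : μ' (Zspace V)ᶜ = 0)
    (hμ'L : ∀ θ ∈ Pcone V, laplace μ' θ = ENNReal.ofReal (Δf (-s') θ)) :
    ((∀ (f : Mat r n →ₗ[ℝ] ℝ) (c : ℝ), (∃ x ∈ Zspace V, f x ≠ 0) →
        μ {x | f x = c}ᶜ ≠ 0) ↔ ∀ k, 0 < s k) ∧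
    ((∀ (f : Mat r n →ₗ[ℝ] ℝ) (c : ℝ), (∃ x ∈ Zspace V, f x ≠ 0) →
        μ' {x | f x = c}ᶜ ≠ 0) ↔ ∀ k, 0 < s' k) := by
  have hQ := isConeAction_rstar hV1 hV2 hV3 hrstar
  have hP := isConeAction_rhoM hV1 hV2 hV3
  refine ⟨hQ.not_concentrated_iff (fun T hT => ?_) hμsupp (nonneg_of_mem_XiSet hs),
    hP.not_concentrated_iff (fun T hT => ?_) hμ'supp (nonneg_of_mem_frakX hs')⟩
  · rw [hμL _ (hQ.map_cone T hT 1 (hQ.Pcone_subset one_mem_Pcone)), hδ _ T hT]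
  · rw [hμ'L _ (hP.map_cone T hT 1 one_mem_Pcone), hΔ _ T hT]

end Wishart
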